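/- Let d be a real number with 0 ≤ d < 1/2. Then the iterated integral ∫₀¹∫₀^{y₁}∫₀^{y₂}∫₀^{y₃}∫₀^{y₄} (y₁−y₂)^(−d)(y₃−y₄)^(−d)(y₁−y₄)^(−d)(y₂−y₅)^(−d)(y₃−y₅)^(−d) dy₅ dy₄ dy₃ dy₂ dy₁ equals (Γ(1−d)/(2(1−d)²))·(Γ(3−3d)·Γ(4−5d)/(Γ(4−4d)·Γ(6−5d)))·₄F₃(1, d, 2−2d, 3−3d; 2−d, 3−2d, 4−4d; 1). -/

import Mathlib

open Real

noncomputable def poch (a : ℝ) (k : ℕ) : ℝ := ∏ i ∈ Finset.range k, (a + i)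

noncomputable def F21 (a b c x : ℝ) : ℝ :=
  ∑' k : ℕ, poch a k * poch b k / (poch c k * (Nat.factorial k : ℝ)) * x ^ k

noncomputable def F32 (a b c e f : ℝ) : ℝ :=
  ∑' k : ℕ, poch a k * poch b k * poch c k / (poch e k * poch f k * (Nat.factorial k : ℝ))

noncomputable def F32x (a b c e f x : ℝ) : ℝ :=
  ∑' k : ℕ, poch a k * poch b k * poch c k / (poch e k * poch f k * (Nat.factorial k : ℝ)) * x ^ k

noncomputable def F43 (a b c g e f h : ℝ) : ℝ :=
  ∑' k : ℕ, poch a k * poch b k * poch c k * poch g k /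
    (poch e k * poch f k * poch h k * (Nat.factorial k : ℝ))

open MeasureTheory

noncomputable def PP (s x : ℝ) : ENNReal := if 0 < x then ENNReal.ofReal (x ^ (s-1)) else 0

@[fun_prop]
lemma PP_meas (s : ℝ) : Measurable (PP s) := by
  unfold PP
  exact Measurable.ite measurableSet_Ioi (by fun_prop) measurable_const

lemma PP_pos (s : ℝ) {x : ℝ} (h : 0 < x) : PP s x = ENNReal.ofReal (x ^ (s-1)) := if_pos h
lemma PP_neg (s : ℝ) {x : ℝ} (h : x ≤ 0) : PP s x = 0 := if_neg (not_lt.2 h)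

lemma PP_mul (s t r x : ℝ) (h : s + t = r + 1) : PP s x * PP t x = PP r x := by
  rcases lt_or_ge 0 x with hx | hx
  · rw [PP_pos _ hx, PP_pos _ hx, PP_pos _ hx, ← ENNReal.ofReal_mul (by positivity), ← rpow_add hx]
    congr 2; linarith
  · simp [PP_neg _ hx]

lemma PP_beta (s t p q : ℝ) (hs : 0 < s) (ht : 0 < t) :
    ∫⁻ x, PP s (x - p) * PP t (q - x) =
      ENNReal.ofReal (ProbabilityTheory.beta s t) * PP (s+t) (q-p) := by
  rcases lt_or_ge p q with h | h
  · have hL : 0 < q - p := sub_pos.2 h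
    have hb := ProbabilityTheory.beta_pos hs ht
    have key : ∀ y, PP s ((q-p) * y + p - p) * PP t (q - ((q-p) * y + p)) =
        ENNReal.ofReal (ProbabilityTheory.beta s t * (q-p)^(s+t-2)) * ProbabilityTheory.betaPDF s t y := by
      intro y
      have e1 : (q-p) * y + p - p = (q-p) * y := by ring
      have e2 : q - ((q-p) * y + p) = (q-p) * (1-y) := by ring
      rw [e1, e2]
      rcases le_or_gt y 0 with hy | hy
      · rw [PP_neg s (by nlinarith), ProbabilityTheory.betaPDF_eq_zero_of_nonpos hy]; simp
      rcases le_or_gt 1 y with hy1 | hy1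
      · rw [PP_neg t (by nlinarith), ProbabilityTheory.betaPDF_eq_zero_of_one_le hy1]; simp
      have hy2 : 0 < 1 - y := by linarith
      rw [PP_pos _ (by positivity), PP_pos _ (by positivity),
        ProbabilityTheory.betaPDF_of_pos_lt_one hy hy1, ← ENNReal.ofReal_mul (by positivity),
        ← ENNReal.ofReal_mul (by positivity), mul_rpow hL.le hy.le, mul_rpow hL.le hy2.le]
      congr 1
      have : (q-p)^(s+t-2) = (q-p)^(s-1) * (q-p)^(t-1) := by
        rw [← rpow_add hL]; congr 1; ring
      rw [this]; field_simp
    have h1 : ∫⁻ x, PP s (x - p) * PP t (q - x) =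
        ENNReal.ofReal (q-p) * ∫⁻ y, PP s ((q-p) * y + p - p) * PP t (q - ((q-p) * y + p)) := by
      rw [← lintegral_add_right_eq_self (fun x => PP s (x - p) * PP t (q - x)) p]
      conv_lhs => rw [← Real.smul_map_volume_mul_left hL.ne']
      rw [lintegral_smul_measure, lintegral_map (by fun_prop) (by fun_prop), abs_of_pos hL]
      rfl
    rw [h1]
    simp_rw [key]
    rw [lintegral_const_mul' _ _ ENNReal.ofReal_ne_top, ProbabilityTheory.lintegral_betaPDF_eq_one hs ht,
      PP_pos _ hL, mul_one, ← ENNReal.ofReal_mul hL.le, ← ENNReal.ofReal_mul hb.le]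
    congr 1
    have : (q-p)^(s+t-1) = (q-p)^(s+t-2) * (q-p) := by
      rw [← rpow_add_one hL.ne']; congr 1; ring
    rw [this]; ring
  · rw [PP_neg _ (by linarith : q - p ≤ 0), mul_zero]
    rw [lintegral_eq_zero_iff (by fun_prop)]
    refine Filter.Eventually.of_forall fun x => ?_
    rcases le_total x p with h' | h'
    · simp [PP_neg s (by linarith : x - p ≤ 0)]
    · simp [PP_neg t (by linarith : q - x ≤ 0)]

lemma poch_nonneg {a : ℝ} (h : 0 ≤ a) (k : ℕ) : 0 ≤ poch a k :=
  Finset.prod_nonneg fun i _ => by positivity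
lemma poch_pos {a : ℝ} (h : 0 < a) (k : ℕ) : 0 < poch a k :=
  Finset.prod_pos fun i _ => by positivity
lemma poch_succ (a : ℝ) (k : ℕ) : poch a (k+1) = poch a k * (a + k) := Finset.prod_range_succ _ _

lemma poch_one (k : ℕ) : poch 1 k = (k.factorial : ℝ) := by
  induction k with
  | zero => simp [poch]
  | succ n ih => rw [poch_succ, ih, Nat.factorial_succ]; push_cast; ring

lemma asc_poch (a : ℝ) (k : ℕ) : (ascPochhammer ℝ k).eval a = poch a k := by
  induction k with
  | zero => simp [poch]
  | succ n ih => rw [poch_succ, ascPochhammer_succ_eval, ih]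

lemma poch_choose (d : ℝ) (k : ℕ) : Ring.choose (d + k - 1) k = poch d k / k.factorial := by
  rw [Ring.choose_eq_smul, Polynomial.descPochhammer_smeval_eq_ascPochhammer,
    Polynomial.ascPochhammer_smeval_cast, Polynomial.ascPochhammer_smeval_eq_eval,
    show d + k - 1 - k + 1 = d by ring, asc_poch]
  simp only [smul_eq_mul]; ring

lemma binom_series (d x : ℝ) (h0 : 0 ≤ x) (h1 : x < 1) :
    HasSum (fun k : ℕ => poch d k / k.factorial * x ^ k) ((1-x)^(-d)) := by
  have := (Real.one_div_one_sub_rpow_hasFPowerSeriesOnBall_zero d).hasSum (y := x) (by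
    simp [Metric.mem_eball, edist_dist]; rw [abs_of_nonneg h0]; exact h1)
  simp only [zero_add] at this
  rw [rpow_neg (by linarith), ← one_div]
  have e : (fun k : ℕ => poch d k / k.factorial * x ^ k) = fun n =>
    (FormalMultilinearSeries.ofScalars ℝ (fun n : ℕ => Ring.choose (d + n - 1) n) n) fun _ => x := by
    funext k
    simp [poch_choose, FormalMultilinearSeries.ofScalars]
  rw [e]; exact this

lemma PP_series (d L z : ℝ) (h0 : 0 ≤ d) (hz : z < L) :
    PP 1 z * PP (1-d) (L - z) =
     ∑' k : ℕ, ENNReal.ofReal (poch d k / k.factorial) * PP (1-d-k) L * PP (1+k) z := by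
  rcases lt_or_ge 0 z with h | h
  · have hL : 0 < L := h.trans hz
    have hs := binom_series d (z/L) (by positivity) ((div_lt_one hL).2 hz)
    have hs2 := hs.mul_left (L^(-d))
    have e : L^(-d) * (1 - z/L)^(-d) = (L - z)^(-d) := by
      rw [← mul_rpow hL.le (by rw [sub_nonneg]; exact ((div_lt_one hL).2 hz).le)]
      congr 1; field_simp
    rw [e] at hs2
    rw [PP_pos _ h, PP_pos _ (by linarith : 0 < L - z), show (1:ℝ)-1 = 0 by ring, rpow_zero,
      ENNReal.ofReal_one, one_mul, show 1 - d - 1 = -d by ring, ← hs2.tsum_eq,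
      ENNReal.ofReal_tsum_of_nonneg _ hs2.summable]
    · congr 1; ext k
      rw [PP_pos _ h, PP_pos _ hL, ← ENNReal.ofReal_mul (by have := poch_nonneg h0 k; positivity),
        ← ENNReal.ofReal_mul (by have := poch_nonneg h0 k; positivity)]
      congr 1
      rw [show 1 - d - k - 1 = -d - k by ring, show (1:ℝ) + k - 1 = k by ring, rpow_sub hL,
        rpow_natCast, rpow_natCast, div_pow]
      field_simp
    · intro k; have := poch_nonneg h0 k; positivity
  · simp [PP_neg _ h]

noncomputable def FF (d y1 y2 y3 y4 y5 : ℝ) : ENNReal :=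
  PP 1 (1-y1) * PP (1-d) (y1-y2) * PP 1 (y2-y3) * PP (1-d) (y3-y4) * PP 1 (y4-y5) * PP 1 (y5 - 0)
    * PP (1-d) (y1-y4) * PP (1-d) (y2-y5) * PP (1-d) (y3-y5)

open ProbabilityTheory in
lemma int4 (d y1 y2 y3 y5 : ℝ) (h0 : 0 ≤ d) (h1 : d < 1/2) :
    ∫⁻ y4, FF d y1 y2 y3 y4 y5 = ∑' k : ℕ, (ENNReal.ofReal (poch d k / k.factorial) *
      ENNReal.ofReal (beta (1+k) (1-d)) * PP 1 (1-y1) * PP 1 (y5-0) * PP (1-d-k) (y1-y5) *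
      PP (1-d) (y1-y2) * PP (1-d) (y2-y5)) * (PP (2+k-2*d) (y3-y5) * PP 1 (y2-y3)) := by
  have key : ∀ y4, FF d y1 y2 y3 y4 y5 = ∑' k : ℕ, (ENNReal.ofReal (poch d k / k.factorial) *
      PP 1 (1-y1) * PP 1 (y5-0) * PP (1-d-k) (y1-y5) *
      PP (1-d) (y1-y2) * PP (1-d) (y2-y5) * PP 1 (y2-y3) * PP (1-d) (y3-y5)) *
        (PP (1+k) (y4-y5) * PP (1-d) (y3-y4)) := by
    intro y4
    rcases lt_or_ge y4 y1 with h | h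
    · have hs := PP_series d (y1-y5) (y4-y5) h0 (by linarith)
      rw [show y1 - y5 - (y4 - y5) = y1 - y4 by ring] at hs
      have : FF d y1 y2 y3 y4 y5 = (PP 1 (1-y1) * PP 1 (y5-0) *
        PP (1-d) (y1-y2) * PP (1-d) (y2-y5) * PP 1 (y2-y3) * PP (1-d) (y3-y5) * PP (1-d) (y3-y4)) *
          (PP 1 (y4-y5) * PP (1-d) (y1-y4)) := by
        unfold FF; ring
      rw [this, hs, ← ENNReal.tsum_mul_left]
      congr 1; ext k; ring
    · have z : PP (1-d) (y1-y2) * PP 1 (y2-y3) * PP (1-d) (y3-y4) = 0 := by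
        rcases le_or_gt y3 y4 with h3 | h3
        · simp [PP_neg (1-d) (by linarith : y3 - y4 ≤ 0)]
        rcases le_or_gt y2 y3 with h2 | h2
        · simp [PP_neg 1 (by linarith : y2 - y3 ≤ 0)]
        simp [PP_neg (1-d) (by linarith : y1 - y2 ≤ 0)]
      have e1 : FF d y1 y2 y3 y4 y5 = 0 := by
        have : FF d y1 y2 y3 y4 y5 = (PP (1-d) (y1-y2) * PP 1 (y2-y3) * PP (1-d) (y3-y4)) *
          (PP 1 (1-y1) * PP 1 (y4-y5) * PP 1 (y5 - 0)
            * PP (1-d) (y1-y4) * PP (1-d) (y2-y5) * PP (1-d) (y3-y5)) := by unfold FF; ring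
        rw [this, z, zero_mul]
      rw [e1, eq_comm, ENNReal.tsum_eq_zero]
      intro k
      have : (ENNReal.ofReal (poch d k / k.factorial) *
      PP 1 (1-y1) * PP 1 (y5-0) * PP (1-d-k) (y1-y5) *
      PP (1-d) (y1-y2) * PP (1-d) (y2-y5) * PP 1 (y2-y3) * PP (1-d) (y3-y5)) *
        (PP (1+k) (y4-y5) * PP (1-d) (y3-y4)) = (PP (1-d) (y1-y2) * PP 1 (y2-y3) * PP (1-d) (y3-y4)) *
        (ENNReal.ofReal (poch d k / k.factorial) *
      PP 1 (1-y1) * PP 1 (y5-0) * PP (1-d-k) (y1-y5) * PP (1-d) (y2-y5) * PP (1-d) (y3-y5) *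
        PP (1+k) (y4-y5)) := by ring
      rw [this, z, zero_mul]
  simp_rw [key]
  rw [lintegral_tsum (fun k => by fun_prop)]
  congr 1; ext k
  rw [lintegral_const_mul _ (by fun_prop), PP_beta _ _ _ _ (by positivity) (by linarith),
    ← PP_mul (1-d) (1+k+(1-d)) (2+k-2*d) (y3-y5) (by ring)]
  ring

noncomputable def AA (d : ℝ) (k : ℕ) : ENNReal :=
  ENNReal.ofReal (poch d k / k.factorial) * ENNReal.ofReal (ProbabilityTheory.beta (1+k) (1-d)) *
  ENNReal.ofReal (ProbabilityTheory.beta (2+k-2*d) 1) *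
  ENNReal.ofReal (ProbabilityTheory.beta (3+k-3*d) (1-d)) *
  ENNReal.ofReal (ProbabilityTheory.beta (4-5*d) 1) *
  ENNReal.ofReal (ProbabilityTheory.beta (5-5*d) 1)

open ProbabilityTheory in
lemma int3 (d y1 y2 y5 : ℝ) (h0 : 0 ≤ d) (h1 : d < 1/2) :
    ∫⁻ y3, ∫⁻ y4, FF d y1 y2 y3 y4 y5 = ∑' k : ℕ, (ENNReal.ofReal (poch d k / k.factorial) *
      ENNReal.ofReal (beta (1+k) (1-d)) * ENNReal.ofReal (beta (2+k-2*d) 1) *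
      PP 1 (1-y1) * PP 1 (y5-0) * PP (1-d-k) (y1-y5)) *
      (PP (3+k-3*d) (y2-y5) * PP (1-d) (y1-y2)) := by
  simp_rw [int4 d _ _ _ _ h0 h1]
  rw [lintegral_tsum (fun k => by fun_prop)]
  congr 1; ext k
  have hk : (0:ℝ) ≤ k := by positivity
  rw [lintegral_const_mul _ (by fun_prop), PP_beta _ _ _ _ (by linarith) (by linarith),
    ← PP_mul (1-d) (2+k-2*d+1) (3+k-3*d) (y2-y5) (by ring)]
  ring

open ProbabilityTheory in
lemma int2 (d y1 y5 : ℝ) (h0 : 0 ≤ d) (h1 : d < 1/2) :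
    ∫⁻ y2, ∫⁻ y3, ∫⁻ y4, FF d y1 y2 y3 y4 y5 = ∑' k : ℕ, (ENNReal.ofReal (poch d k / k.factorial) *
      ENNReal.ofReal (beta (1+k) (1-d)) * ENNReal.ofReal (beta (2+k-2*d) 1) *
      ENNReal.ofReal (beta (3+k-3*d) (1-d)) * PP 1 (1-y1)) *
      (PP 1 (y5-0) * PP (4-5*d) (y1-y5)) := by
  simp_rw [int3 d _ _ _ h0 h1]
  rw [lintegral_tsum (fun k => by fun_prop)]
  congr 1; ext k
  have hk : (0:ℝ) ≤ k := by positivity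
  rw [lintegral_const_mul _ (by fun_prop), PP_beta _ _ _ _ (by linarith) (by linarith),
    ← PP_mul (1-d-k) (3+k-3*d+(1-d)) (4-5*d) (y1-y5) (by ring)]
  ring

open ProbabilityTheory in
lemma int1 (d : ℝ) (h0 : 0 ≤ d) (h1 : d < 1/2) :
    ∫⁻ y1, ∫⁻ y5, ∫⁻ y2, ∫⁻ y3, ∫⁻ y4, FF d y1 y2 y3 y4 y5 = ∑' k : ℕ, AA d k := by
  have e : ∀ y1, ∫⁻ y5, ∫⁻ y2, ∫⁻ y3, ∫⁻ y4, FF d y1 y2 y3 y4 y5 =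
      ∑' k : ℕ, (ENNReal.ofReal (poch d k / k.factorial) *
      ENNReal.ofReal (beta (1+k) (1-d)) * ENNReal.ofReal (beta (2+k-2*d) 1) *
      ENNReal.ofReal (beta (3+k-3*d) (1-d)) * ENNReal.ofReal (beta (4-5*d) 1)) *
      (PP (5-5*d) (y1-0) * PP 1 (1-y1)) := by
    intro y1
    simp_rw [int2 d _ _ h0 h1]
    rw [lintegral_tsum (fun k => by fun_prop)]
    congr 1; ext k
    rw [lintegral_const_mul _ (by fun_prop), PP_beta _ _ _ _ (by linarith) (by linarith),
      show 1 + (4-5*d) = 5 - 5*d by ring]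
    rw [show beta 1 (4-5*d) = beta (4-5*d) 1 by unfold beta; rw [add_comm, mul_comm]]
    ring
  simp_rw [e]
  rw [lintegral_tsum (fun k => by fun_prop)]
  congr 1; ext k
  rw [lintegral_const_mul _ (by fun_prop), PP_beta _ _ _ _ (by linarith) (by linarith),
    PP_pos _ (by norm_num)]
  simp [AA, mul_assoc]

lemma swaps (d : ℝ) : ∫⁻ y1, ∫⁻ y2, ∫⁻ y3, ∫⁻ y4, ∫⁻ y5, FF d y1 y2 y3 y4 y5 =
    ∫⁻ y1, ∫⁻ y5, ∫⁻ y2, ∫⁻ y3, ∫⁻ y4, FF d y1 y2 y3 y4 y5 := by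
  congr 1; ext y1
  have e1 : ∀ y2 y3, ∫⁻ y4, ∫⁻ y5, FF d y1 y2 y3 y4 y5 = ∫⁻ y5, ∫⁻ y4, FF d y1 y2 y3 y4 y5 := by
    intro y2 y3
    refine lintegral_lintegral_swap ?_
    unfold FF Function.uncurry; fun_prop
  have e2 : ∀ y2, ∫⁻ y3, ∫⁻ y5, ∫⁻ y4, FF d y1 y2 y3 y4 y5 =
      ∫⁻ y5, ∫⁻ y3, ∫⁻ y4, FF d y1 y2 y3 y4 y5 := by
    intro y2
    refine lintegral_lintegral_swap ?_
    unfold FF Function.uncurry; fun_prop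
  simp_rw [e1, e2]
  refine lintegral_lintegral_swap ?_
  unfold FF Function.uncurry; fun_prop

lemma real_eq (d : ℝ) (hfin : ∫⁻ y1, ∫⁻ y2, ∫⁻ y3, ∫⁻ y4, ∫⁻ y5, FF d y1 y2 y3 y4 y5 ≠ ⊤) :
    ∫ y1, ∫ y2, ∫ y3, ∫ y4, ∫ y5, (FF d y1 y2 y3 y4 y5).toReal =
    (∫⁻ y1, ∫⁻ y2, ∫⁻ y3, ∫⁻ y4, ∫⁻ y5, FF d y1 y2 y3 y4 y5).toReal := by
  have m1 : Measurable fun y1 => ∫⁻ y2, ∫⁻ y3, ∫⁻ y4, ∫⁻ y5, FF d y1 y2 y3 y4 y5 := by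
    unfold FF; fun_prop
  have m2 : ∀ y1, Measurable fun y2 => ∫⁻ y3, ∫⁻ y4, ∫⁻ y5, FF d y1 y2 y3 y4 y5 := by
    unfold FF; fun_prop
  have m3 : ∀ y1 y2, Measurable fun y3 => ∫⁻ y4, ∫⁻ y5, FF d y1 y2 y3 y4 y5 := by
    unfold FF; fun_prop
  have m4 : ∀ y1 y2 y3, Measurable fun y4 => ∫⁻ y5, FF d y1 y2 y3 y4 y5 := by
    unfold FF; fun_prop
  have m5 : ∀ y1 y2 y3 y4, Measurable fun y5 => FF d y1 y2 y3 y4 y5 := by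
    unfold FF; fun_prop
  have a1 := ae_lt_top m1 hfin
  rw [← integral_toReal m1.aemeasurable a1]
  refine integral_congr_ae ?_
  filter_upwards [a1] with y1 h1
  have a2 := ae_lt_top (m2 y1) h1.ne
  rw [← integral_toReal (m2 y1).aemeasurable a2]
  refine integral_congr_ae ?_
  filter_upwards [a2] with y2 h2
  have a3 := ae_lt_top (m3 y1 y2) h2.ne
  rw [← integral_toReal (m3 y1 y2).aemeasurable a3]
  refine integral_congr_ae ?_
  filter_upwards [a3] with y3 h3
  have a4 := ae_lt_top (m4 y1 y2 y3) h3.ne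
  rw [← integral_toReal (m4 y1 y2 y3).aemeasurable a4]
  refine integral_congr_ae ?_
  filter_upwards [a4] with y4 h4
  have a5 := ae_lt_top (m5 y1 y2 y3 y4) h4.ne
  rw [← integral_toReal (m5 y1 y2 y3 y4).aemeasurable a5]

lemma ivl (b : ℝ) (hb : 0 ≤ b) (h g : ℝ → ℝ) (h1 : ∀ x, 0 < x → x < b → h x = g x)
    (h2 : ∀ x, ¬ (0 < x ∧ x < b) → g x = 0) : ∫ x in (0:ℝ)..b, h x = ∫ x, g x := by
  rw [intervalIntegral.integral_of_le hb, integral_Ioc_eq_integral_Ioo,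
    setIntegral_congr_fun measurableSet_Ioo (g := g) (fun x hx => h1 x hx.1 hx.2)]
  refine setIntegral_eq_integral_of_forall_compl_eq_zero fun x hx => h2 x hx

lemma FF_zero (d y1 y2 y3 y4 y5 : ℝ)
    (h : ¬ (0 < y5 ∧ y5 < y4 ∧ y4 < y3 ∧ y3 < y2 ∧ y2 < y1 ∧ y1 < 1)) :
    FF d y1 y2 y3 y4 y5 = 0 := by
  by_contra hne
  apply h
  unfold FF at hne
  simp only [mul_ne_zero_iff, ne_eq] at hne
  have : ∀ s x, PP s x ≠ 0 → 0 < x := fun s x hx => by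
    by_contra hh; exact hx (PP_neg s (not_lt.1 hh))
  obtain ⟨⟨⟨⟨⟨⟨⟨⟨q1, q2⟩, q3⟩, q4⟩, q5⟩, q6⟩, -⟩, -⟩, -⟩ := hne
  have r1 := this _ _ q1
  have r2 := this _ _ q2
  have r3 := this _ _ q3
  have r4 := this _ _ q4
  have r5 := this _ _ q5
  have r6 := this _ _ q6
  refine ⟨?_, ?_, ?_, ?_, ?_, ?_⟩ <;> linarith

lemma lhs_eq (d : ℝ) : (∫ y1 in (0:ℝ)..1, ∫ y2 in (0:ℝ)..y1, ∫ y3 in (0:ℝ)..y2, ∫ y4 in (0:ℝ)..y3, ∫ y5 in (0:ℝ)..y4,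
      (y1 - y2) ^ (-d) * (y3 - y4) ^ (-d) * (y1 - y4) ^ (-d) * (y2 - y5) ^ (-d) * (y3 - y5) ^ (-d)) =
    ∫ y1, ∫ y2, ∫ y3, ∫ y4, ∫ y5, (FF d y1 y2 y3 y4 y5).toReal := by
  have Z5 := fun y1 y2 y3 y4 y5 h => congrArg ENNReal.toReal (FF_zero d y1 y2 y3 y4 y5 h)
  simp only [ENNReal.toReal_zero] at Z5
  have Z4 : ∀ y1 y2 y3 y4, ¬ (0 < y4 ∧ y4 < y3 ∧ y3 < y2 ∧ y2 < y1 ∧ y1 < 1) →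
      ∫ y5, (FF d y1 y2 y3 y4 y5).toReal = 0 := by
    intro y1 y2 y3 y4 h
    rw [← integral_zero ℝ ℝ]; congr 1; ext y5; exact Z5 _ _ _ _ _ (by grind)
  have Z3 : ∀ y1 y2 y3, ¬ (0 < y3 ∧ y3 < y2 ∧ y2 < y1 ∧ y1 < 1) →
      ∫ y4, ∫ y5, (FF d y1 y2 y3 y4 y5).toReal = 0 := by
    intro y1 y2 y3 h
    rw [← integral_zero ℝ ℝ]; congr 1; ext y4; exact Z4 _ _ _ _ (by grind)
  have Z2 : ∀ y1 y2, ¬ (0 < y2 ∧ y2 < y1 ∧ y1 < 1) →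
      ∫ y3, ∫ y4, ∫ y5, (FF d y1 y2 y3 y4 y5).toReal = 0 := by
    intro y1 y2 h
    rw [← integral_zero ℝ ℝ]; congr 1; ext y3; exact Z3 _ _ _ (by grind)
  have Z1 : ∀ y1, ¬ (0 < y1 ∧ y1 < 1) →
      ∫ y2, ∫ y3, ∫ y4, ∫ y5, (FF d y1 y2 y3 y4 y5).toReal = 0 := by
    intro y1 h
    rw [← integral_zero ℝ ℝ]; congr 1; ext y2; exact Z2 _ _ (by grind)
  refine ivl 1 zero_le_one _ _ (fun y1 p1 q1 => ?_) (fun y1 h => Z1 _ h)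
  refine ivl y1 p1.le _ _ (fun y2 p2 q2 => ?_) (fun y2 h => Z2 _ _ (by grind))
  refine ivl y2 p2.le _ _ (fun y3 p3 q3 => ?_) (fun y3 h => Z3 _ _ _ (by grind))
  refine ivl y3 p3.le _ _ (fun y4 p4 q4 => ?_) (fun y4 h => Z4 _ _ _ _ (by grind))
  refine ivl y4 p4.le _ _ (fun y5 p5 q5 => ?_) (fun y5 h => Z5 _ _ _ _ _ (by grind))
  have t : ∀ s x, 0 < x → (PP s x).toReal = x ^ (s-1) := fun s x hx => by
    rw [PP_pos _ hx, ENNReal.toReal_ofReal (by positivity)]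
  unfold FF
  simp only [ENNReal.toReal_mul]
  rw [t _ _ (by linarith), t _ _ (by linarith), t _ _ (by linarith), t _ _ (by linarith),
    t _ _ (by linarith), t _ _ (by linarith), t _ _ (by linarith), t _ _ (by linarith), t _ _ (by linarith)]
  simp

lemma Gamma_poch {a : ℝ} (h : 0 < a) (k : ℕ) : Gamma (a + k) = poch a k * Gamma a := by
  induction k with
  | zero => simp [poch]
  | succ n ih =>
    rw [poch_succ]; push_cast
    rw [← add_assoc, Gamma_add_one (by positivity), ih]; ring

lemma poch_shift (a : ℝ) (k : ℕ) : poch a k * (a + k) = a * poch (a+1) k := by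
  induction k with
  | zero => simp [poch]
  | succ n ih =>
    rw [poch_succ, ih, poch_succ]; push_cast; ring

noncomputable def tm (d : ℝ) (k : ℕ) : ℝ :=
  poch 1 k * poch d k * poch (2-2*d) k * poch (3-3*d) k /
    (poch (2-d) k * poch (3-2*d) k * poch (4-4*d) k * (Nat.factorial k : ℝ))

lemma tm_nonneg (d : ℝ) (h0 : 0 ≤ d) (h1 : d < 1/2) (k : ℕ) : 0 ≤ tm d k := by
  have := poch_nonneg h0 k
  have := poch_pos (by linarith : 0 < 2-d) k
  have := poch_pos (by linarith : 0 < 2-2*d) k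
  have := poch_pos (by linarith : 0 < 3-2*d) k
  have := poch_pos (by linarith : 0 < 3-3*d) k
  have := poch_pos (by linarith : 0 < 4-4*d) k
  have := poch_pos one_pos k
  unfold tm; positivity

lemma tm_le (d : ℝ) (h0 : 0 ≤ d) (h1 : d < 1/2) (k : ℕ) : tm d k ≤ 2 * (1 / ((k:ℝ)+1)^2) := by
  have p1 := poch_nonneg h0 k
  have p2 := poch_pos (by linarith : 0 < 2-d) k
  have p3 := poch_pos (by linarith : 0 < 2-2*d) k
  have p4 := poch_pos (by linarith : 0 < 3-2*d) k
  have p5 := poch_pos (by linarith : 0 < 3-3*d) k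
  have p6 := poch_pos (by linarith : 0 < 4-4*d) k
  have a : ∀ k : ℕ, poch d k * (2*k+1) ≤ poch (2-d) k := by
    intro k
    induction k with
    | zero => simp [poch]
    | succ n ih =>
      have := poch_nonneg h0 n
      have hn : (0:ℝ) ≤ n := by positivity
      rw [poch_succ, poch_succ]; push_cast
      calc poch d n * (d + n) * (2 * (n+1) + 1) = poch d n * ((d + n) * (2 * (n+1) + 1)) := by ring
        _ ≤ poch d n * ((2*n+1) * (2 - d + n)) := by
          apply mul_le_mul_of_nonneg_left _ this
          nlinarith
        _ = (poch d n * (2*n+1)) * (2 - d + n) := by ring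
        _ ≤ _ := mul_le_mul_of_nonneg_right ih (by linarith)
  have hk : (0:ℝ) ≤ k := by positivity
  have a' : poch d k / poch (2-d) k ≤ 1 / (k+1) := by
    rw [div_le_div_iff₀ p2 (by positivity)]
    nlinarith [a k]
  have b' : poch (2-2*d) k / poch (3-2*d) k ≤ 2 / (k+1) := by
    rw [div_le_div_iff₀ p4 (by positivity)]
    have := poch_shift (2-2*d) k
    rw [show 2 - 2*d + 1 = 3 - 2*d by ring] at this
    nlinarith
  have c' : poch (3-3*d) k / poch (4-4*d) k ≤ 1 := by
    rw [div_le_one p6]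
    exact Finset.prod_le_prod (fun i _ => by have : (0:ℝ) ≤ i := by positivity
                                             linarith) (fun i _ => by linarith)
  have : tm d k = (poch d k / poch (2-d) k) * (poch (2-2*d) k / poch (3-2*d) k) *
      (poch (3-3*d) k / poch (4-4*d) k) := by
    unfold tm; rw [poch_one]; field_simp
  rw [this]
  calc _ ≤ (1 / ((k:ℝ)+1)) * (2 / (k+1)) * 1 := by gcongr
    _ = _ := by field_simp

lemma tm_summable (d : ℝ) (h0 : 0 ≤ d) (h1 : d < 1/2) : Summable (tm d) := by
  refine Summable.of_nonneg_of_le (tm_nonneg d h0 h1) (tm_le d h0 h1) (Summable.mul_left _ ?_)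
  have := (summable_nat_add_iff 1).2 (Real.summable_one_div_nat_pow.2 (one_lt_two))
  simpa using this

lemma AA_eq (d : ℝ) (h0 : 0 ≤ d) (h1 : d < 1/2) (k : ℕ) : AA d k = ENNReal.ofReal
    (Gamma (1-d) / (2 * (1-d) ^ 2) * (Gamma (3-3*d) * Gamma (4-5*d) / (Gamma (4-4*d) * Gamma (6-5*d))) *
    tm d k) := by
  have hk : (0:ℝ) ≤ k := by positivity
  have p1 := poch_nonneg h0 k
  have p2 := poch_pos (by linarith : 0 < 2-d) k
  have p3 := poch_pos (by linarith : 0 < 2-2*d) k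
  have p4 := poch_pos (by linarith : 0 < 3-2*d) k
  have p5 := poch_pos (by linarith : 0 < 3-3*d) k
  have p6 := poch_pos (by linarith : 0 < 4-4*d) k
  have b1 := ProbabilityTheory.beta_pos (by linarith : (0:ℝ) < 1+k) (by linarith : 0 < 1-d)
  have b2 := ProbabilityTheory.beta_pos (by linarith : (0:ℝ) < 2+k-2*d) (one_pos)
  have b3 := ProbabilityTheory.beta_pos (by linarith : (0:ℝ) < 3+k-3*d) (by linarith : 0 < 1-d)
  have b4 := ProbabilityTheory.beta_pos (by linarith : (0:ℝ) < 4-5*d) (one_pos)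
  have b5 := ProbabilityTheory.beta_pos (by linarith : (0:ℝ) < 5-5*d) (one_pos)
  unfold AA
  rw [← ENNReal.ofReal_mul (by positivity), ← ENNReal.ofReal_mul (by positivity),
    ← ENNReal.ofReal_mul (by positivity), ← ENNReal.ofReal_mul (by positivity),
    ← ENNReal.ofReal_mul (by positivity)]
  congr 1
  unfold ProbabilityTheory.beta tm
  have g1 := Gamma_poch one_pos k
  have g2 := Gamma_poch (by linarith : 0 < 2-d) k
  have g3 := Gamma_poch (by linarith : 0 < 2-2*d) k
  have g4 := Gamma_poch (by linarith : 0 < 3-2*d) k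
  have g5 := Gamma_poch (by linarith : 0 < 3-3*d) k
  have g6 := Gamma_poch (by linarith : 0 < 4-4*d) k
  have g7 := Gamma_add_one (by linarith : 1-d ≠ 0)
  have g8 := Gamma_add_one (by linarith : 2-2*d ≠ 0)
  rw [show 1 + (k:ℝ) + (1 - d) = 2 - d + k by ring, show 2 + (k:ℝ) - 2*d + 1 = 3-2*d+k by ring,
    show 3 + (k:ℝ) - 3*d + (1-d) = 4-4*d+k by ring, show 4 - 5*d+1 = 5-5*d by ring,
    show 5 - 5*d+1 = 6-5*d by ring, show 2 + (k:ℝ) - 2*d = 2-2*d+k by ring,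
    show 3 + (k:ℝ) - 3*d = 3-3*d+k by ring, g1, g2, g3, g4, g5, g6,
    show 2 - d = 1 - d + 1 by ring, show 3 - 2*d = 2-2*d+1 by ring, g7, g8, Gamma_one, poch_one]
  rw [show 1 - d + 1 = 2 - d by ring, show 2-2*d+1 = 3 - 2*d by ring]
  have q1 := Gamma_pos_of_pos (by linarith : 0 < 1-d)
  have q2 := Gamma_pos_of_pos (by linarith : 0 < 2-2*d)
  have q3 := Gamma_pos_of_pos (by linarith : 0 < 4-4*d)
  have q4 := Gamma_pos_of_pos (by linarith : 0 < 5-5*d)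
  have q5 := Gamma_pos_of_pos (by linarith : 0 < 6-5*d)
  have hd : 1 - d ≠ 0 := by linarith
  rw [show 2 - 2*d = 2 * (1-d) by ring] at *
  generalize Gamma (1-d) = G1 at *
  generalize Gamma (2*(1-d)) = G2 at *
  generalize Gamma (4-4*d) = G3 at *
  generalize Gamma (5-5*d) = G4 at *
  generalize Gamma (6-5*d) = G5 at *
  generalize poch (2-d) k = P2 at *
  generalize poch (3-2*d) k = P4 at *
  generalize poch (4-4*d) k = P6 at *
  generalize 1 - d = e at *
  field_simp

theorem stmt10 (d : ℝ) (h0 : 0 ≤ d) (h1 : d < 1/2) :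
    (∫ y1 in (0:ℝ)..1, ∫ y2 in (0:ℝ)..y1, ∫ y3 in (0:ℝ)..y2, ∫ y4 in (0:ℝ)..y3, ∫ y5 in (0:ℝ)..y4,
      (y1 - y2) ^ (-d) * (y3 - y4) ^ (-d) * (y1 - y4) ^ (-d) * (y2 - y5) ^ (-d) * (y3 - y5) ^ (-d)) =
    Gamma (1-d) / (2 * (1-d) ^ 2) * (Gamma (3-3*d) * Gamma (4-5*d) / (Gamma (4-4*d) * Gamma (6-5*d))) *
      F43 1 d (2-2*d) (3-3*d) (2-d) (3-2*d) (4-4*d) := by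
  have hF : F43 1 d (2-2*d) (3-3*d) (2-d) (3-2*d) (4-4*d) = ∑' k, tm d k := rfl
  have hC : 0 ≤ Gamma (1-d) / (2 * (1-d) ^ 2) *
      (Gamma (3-3*d) * Gamma (4-5*d) / (Gamma (4-4*d) * Gamma (6-5*d))) := by
    have := Gamma_pos_of_pos (by linarith : 0 < 1-d)
    have := Gamma_pos_of_pos (by linarith : 0 < 3-3*d)
    have := Gamma_pos_of_pos (by linarith : 0 < 4-5*d)
    have := Gamma_pos_of_pos (by linarith : 0 < 4-4*d)
    have := Gamma_pos_of_pos (by linarith : 0 < 6-5*d)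
    positivity
  have L := (swaps d).trans (int1 d h0 h1)
  simp_rw [AA_eq d h0 h1] at L
  have hnn : ∀ k, 0 ≤ Gamma (1-d) / (2 * (1-d) ^ 2) *
      (Gamma (3-3*d) * Gamma (4-5*d) / (Gamma (4-4*d) * Gamma (6-5*d))) * tm d k :=
    fun k => mul_nonneg hC (tm_nonneg d h0 h1 k)
  rw [← ENNReal.ofReal_tsum_of_nonneg hnn ((tm_summable d h0 h1).mul_left _), tsum_mul_left] at L
  rw [lhs_eq, real_eq d (by rw [L]; exact ENNReal.ofReal_ne_top), L, hF,
    ENNReal.toReal_ofReal (mul_nonneg hC (tsum_nonneg (tm_nonneg d h0 h1)))]
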